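/- Assume (H_c). For every σ ≥ 0 there exists a unique function 𝒱_σ, continuous on [0,1] and C¹ on (0,1), with 𝒱_σ(1) = 0, 𝒱_σ(u) > 0 for u ∈ (0,1), and 𝒱_σ'(u) = σ − f(u)·ℋ(u,𝒱_σ(u)) for u ∈ (0,1). Moreover, the map (u,σ) ↦ 𝒱_σ(u) is continuous on [0,1] × [0,∞), and for each fixed u ∈ (0,1) the map σ ↦ 𝒱_σ(u) is strictly decreasing on [0,∞). -/

import Mathlib

open Set Filter Topology
open scoped ENNReal

noncomputable section

/-- The strip `Ω` between `-ω` and `ω` over `[0,1]`: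
`Ω = {(u,s) : u ∈ [0,1], -ω(u) < s < ω(u)}`. -/
def OmegaSet (ω : ℝ → ℝ≥0∞) : Set (ℝ × ℝ) :=
  {p | p.1 ∈ Set.Icc (0:ℝ) 1 ∧ ENNReal.ofReal |p.2| < ω p.1}

/-- The set `𝒟` between `a₋ = -a₊` and `a₊` over `[0,1]`. -/
def DSet (aplus : ℝ → ℝ≥0∞) : Set (ℝ × ℝ) :=
  {p | p.1 ∈ Set.Icc (0:ℝ) 1 ∧ ENNReal.ofReal |p.2| < aplus p.1}

/-- Standing data and hypotheses: a lower semicontinuous width `ω : [0,1] → (0,∞]`,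
a regular flux `a` on `Ω` (odd in `s`, C¹, with `∂a/∂s > 0`), the maximal fluxes
`a₊(u) = lim_{s→ω(u)⁻} a(u,s)` (equivalently, the supremum over `0 < s < ω(u)`),
which are `+∞` whenever `ω(u) < ∞`, the partial inverse `g` on `𝒟` defined by
`a(u, g(u,v)) = v`, and a logistic-type reaction term `f`. -/
structure FluxData where
  ω : ℝ → ℝ≥0∞
  a : ℝ → ℝ → ℝ
  aplus : ℝ → ℝ≥0∞
  g : ℝ → ℝ → ℝ
  f : ℝ → ℝ
  ω_pos : ∀ u ∈ Set.Icc (0:ℝ) 1, 0 < ω u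
  ω_lsc : LowerSemicontinuousOn ω (Set.Icc (0:ℝ) 1)
  a_odd : ∀ u s, (u, s) ∈ OmegaSet ω → a u (-s) = - a u s
  a_C1 : ContDiffOn ℝ 1 (fun p : ℝ × ℝ => a p.1 p.2) (OmegaSet ω)
  a_deriv_pos : ∀ u s, (u, s) ∈ OmegaSet ω → ∃ d : ℝ, 0 < d ∧ HasDerivAt (a u) d s
  aplus_def : ∀ u ∈ Set.Icc (0:ℝ) 1,
      aplus u = ⨆ s ∈ {s : ℝ | 0 < s ∧ (u, s) ∈ OmegaSet ω}, ENNReal.ofReal (a u s)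
  aplus_pos : ∀ u ∈ Set.Icc (0:ℝ) 1, 0 < aplus u
  aplus_top : ∀ u ∈ Set.Icc (0:ℝ) 1, ω u < ⊤ → aplus u = ⊤
  g_spec : ∀ p ∈ DSet aplus, (p.1, g p.1 p.2) ∈ OmegaSet ω ∧ a p.1 (g p.1 p.2) = p.2
  f_C1 : ContDiffOn ℝ 1 f (Set.Icc (0:ℝ) 1)
  f_zero : f 0 = 0
  f_one : f 1 = 0
  f_pos : ∀ u ∈ Set.Ioo (0:ℝ) 1, 0 < f u

/-- A classic traveling wave of `u_t = (b(u,u_x))_x + f(u)` moving at speed `σ`: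
a C² increasing profile `u` with values in `(0,1)`, `0 < u' < ω(u)`, connecting
`0` at `-∞` to `1` at `+∞`, such that `ξ ↦ b(u(ξ),u'(ξ))` is differentiable and
`(b(u,u'))' - σ u' + f(u) = 0`. -/
def IsClassicTW (F : FluxData) (b : ℝ → ℝ → ℝ) (σ : ℝ) (u : ℝ → ℝ) : Prop :=
  ContDiff ℝ 2 u ∧
  (∀ ξ : ℝ, u ξ ∈ Set.Ioo (0:ℝ) 1) ∧
  (∀ ξ : ℝ, 0 < deriv u ξ ∧ ENNReal.ofReal (deriv u ξ) < F.ω (u ξ)) ∧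
  Filter.Tendsto u Filter.atBot (nhds 0) ∧
  Filter.Tendsto u Filter.atTop (nhds 1) ∧
  (∀ ξ : ℝ, HasDerivAt (fun t => b (u t) (deriv u t)) (σ * deriv u ξ - F.f (u ξ)) ξ)

/-- A right solution with speed `σ`: `V : (α,1] → ℝ`, continuous on `(α,1]`,
C¹ on `(α,1)`, `V(1) = 0`, and on `(α,1)` : `V > 0`, `(u,V(u)) ∈ 𝒟` and
`V' = σ - f(u)/g(u,V(u))`. -/
def IsRightSolution (F : FluxData) (σ α : ℝ) (V : ℝ → ℝ) : Prop :=
  α ∈ Set.Ico (0:ℝ) 1 ∧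
  ContinuousOn V (Set.Ioc α 1) ∧
  V 1 = 0 ∧
  ∀ u ∈ Set.Ioo α 1, 0 < V u ∧ (u, V u) ∈ DSet F.aplus ∧
    HasDerivAt V (σ - F.f u / F.g u (V u)) u

open Classical in
/-- `ℋ(u,V) = 1/g(u,V)` if `0 < V < a₊(u)`, and `0` if `V ≥ a₊(u)`. -/
def Hfun (F : FluxData) (u V : ℝ) : ℝ :=
  if ENNReal.ofReal V < F.aplus u then 1 / F.g u V else 0

/-- The solution `𝒱_σ` of the extended problem: continuous on `[0,1]`, C¹ on `(0,1)`,
`𝒱(1) = 0`, `𝒱 > 0` on `(0,1)` and `𝒱' = σ - f(u)·ℋ(u,𝒱(u))` on `(0,1)`. -/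
def IsVsol (F : FluxData) (σ : ℝ) (V : ℝ → ℝ) : Prop :=
  ContinuousOn V (Set.Icc (0:ℝ) 1) ∧ V 1 = 0 ∧
  (∀ u ∈ Set.Ioo (0:ℝ) 1, 0 < V u) ∧
  (∀ u ∈ Set.Ioo (0:ℝ) 1, HasDerivAt V (σ - F.f u * Hfun F u (V u)) u)

lemma nonpos_of_deriv_nonneg_of_pos {a b : ℝ} {d : ℝ → ℝ} (hd : ContinuousOn d (Icc a b))
    (hb : d b ≤ 0) (h : ∀ u ∈ Ioo a b, 0 < d u → ∃ d' : ℝ, 0 ≤ d' ∧ HasDerivAt d d' u) :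
    ∀ u ∈ Icc a b, d u ≤ 0 := by
  intro u hu
  by_contra! hpos
  have hsub : Icc u b ⊆ Icc a b := Icc_subset_Icc_left hu.1
  have hclosed : IsClosed (Icc u b ∩ d ⁻¹' Iic 0) :=
    (hd.mono hsub).preimage_isClosed_of_isClosed isClosed_Icc isClosed_Iic
  obtain ⟨c, ⟨hc, hdc⟩, hmin⟩ :=
    (isCompact_Icc.of_isClosed_subset hclosed inter_subset_left).exists_isLeast
      ⟨b, ⟨hu.2, le_rfl⟩, hb⟩
  have hder : ∀ x ∈ Ioo u c, ∃ d' : ℝ, 0 ≤ d' ∧ HasDerivAt d d' x := by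
    intro x hx
    refine h x ⟨hu.1.trans_lt hx.1, hx.2.trans_le hc.2⟩ ?_
    by_contra! hx0
    exact absurd (hmin ⟨⟨hx.1.le, hx.2.le.trans hc.2⟩, hx0⟩) hx.2.not_ge
  have hmono : MonotoneOn d (Icc u c) := by
    refine monotoneOn_of_deriv_nonneg (convex_Icc u c)
      (hd.mono ((Icc_subset_Icc_right hc.2).trans hsub)) ?_ ?_ <;> rw [interior_Icc]
    · intro x hx
      obtain ⟨d', -, hd'⟩ := hder x hx
      exact hd'.differentiableAt.differentiableWithinAt
    · intro x hx
      obtain ⟨d', h0, hd'⟩ := hder x hx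
      rwa [hd'.deriv]
  have := hmono ⟨le_rfl, hc.1⟩ ⟨hc.1, le_rfl⟩ hc.1
  have hdc' : d c ≤ 0 := hdc
  linarith

lemma exists_backward_solution_of_lipschitz {G : ℝ → ℝ → ℝ} {C K : NNReal}
    (hcont : ∀ v, Continuous fun u => G u v) (hK : ∀ u, LipschitzWith K (G u))
    (hC : ∀ u v, |G u v| ≤ C) :
    ∃ V : ℝ → ℝ, V 1 = 0 ∧ ContinuousOn V (Icc 0 1) ∧
      ∀ u ∈ Ioo (0 : ℝ) 1, HasDerivAt V (G u (V u)) u := by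
  have hPL : IsPicardLindelof G (tmin := 0) (tmax := 1) ⟨1, by simp⟩ 0 C 0 C K :=
    { lipschitzOnWith := fun t _ => (hK t).lipschitzOnWith
      continuousOn := fun x _ => (hcont x).continuousOn
      norm_le := fun t _ x _ => hC t x
      mul_max_le := by simp }
  obtain ⟨V, hV1, hV⟩ := hPL.exists_eq_forall_mem_Icc_hasDerivWithinAt₀
  refine ⟨V, hV1, fun u hu => (hV u hu).continuousWithinAt, fun u hu => ?_⟩
  exact (hV u (Ioo_subset_Icc_self hu)).hasDerivAt (Icc_mem_nhds hu.1 hu.2)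

lemma exists_uniform_limit {V : ℕ → ℝ → ℝ} (hV : ∀ n, ContinuousOn (V n) (Icc 0 1))
    (hdist : ∀ n m, n ≤ m → ∀ u ∈ Icc (0 : ℝ) 1, |V n u - V m u| ≤ 1 / ((n : ℝ) + 1)) :
    ∃ W : ℝ → ℝ, ContinuousOn W (Icc 0 1) ∧
      (∀ u ∈ Icc (0 : ℝ) 1, Tendsto (fun n => V n u) atTop (𝓝 (W u))) ∧
      ∀ u ∈ Ioo (0 : ℝ) 1, Tendsto (fun p : ℕ × ℝ => V p.1 p.2) (atTop ×ˢ 𝓝 u) (𝓝 (W u)) := by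
  have hpt : ∀ u ∈ Icc (0 : ℝ) 1, ∃ w, Tendsto (fun n => V n u) atTop (𝓝 w) := by
    intro u hu
    refine cauchySeq_tendsto_of_complete
      (cauchySeq_of_le_tendsto_0' (fun n : ℕ => 1 / ((n : ℝ) + 1)) ?_
        tendsto_one_div_add_atTop_nhds_zero_nat)
    intro n m hnm
    exact hdist n m hnm u hu
  choose! W hW using hpt
  have hle : ∀ n, ∀ u ∈ Icc (0 : ℝ) 1, dist (W u) (V n u) ≤ 1 / ((n : ℝ) + 1) := by
    intro n u hu
    rw [dist_comm]
    exact le_of_tendsto (tendsto_const_nhds.dist (hW u hu))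
      (eventually_atTop.2 ⟨n, fun m hm => hdist n m hm u hu⟩)
  have hunif : TendstoUniformlyOn V W atTop (Icc 0 1) := by
    rw [Metric.tendstoUniformlyOn_iff]
    intro ε hε
    filter_upwards [tendsto_one_div_add_atTop_nhds_zero_nat.eventually (gt_mem_nhds hε)]
      with n hn u hu
    exact (hle n u hu).trans_lt hn
  have hWc : ContinuousOn W (Icc 0 1) := hunif.continuousOn (Frequently.of_forall hV)
  refine ⟨W, hWc, hW, fun u hu => ?_⟩
  have hnhds : Icc (0 : ℝ) 1 ∈ 𝓝 u := Icc_mem_nhds hu.1 hu.2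
  have h1 : Tendsto (fun p : ℕ × ℝ => W p.2) (atTop ×ˢ 𝓝 u) (𝓝 (W u)) :=
    ((hWc.continuousAt hnhds).tendsto).comp tendsto_snd
  refine (tendsto_iff_of_dist ?_).1 h1
  refine squeeze_zero' (Eventually.of_forall fun _ => dist_nonneg) ?_
    (tendsto_one_div_add_atTop_nhds_zero_nat.comp tendsto_fst)
  filter_upwards [tendsto_snd.eventually hnhds] with p hp
  exact hle p.1 p.2 hp

lemma hasDerivAt_of_continuous_convergence {s : Set ℝ} (hs : IsOpen s) {V D : ℕ → ℝ → ℝ}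
    {W E : ℝ → ℝ} (hder : ∀ n, ∀ u ∈ s, HasDerivAt (V n) (D n u) u)
    (hV : ∀ u ∈ s, Tendsto (fun n => V n u) atTop (𝓝 (W u)))
    (hE : ContinuousOn E s)
    (hD : ∀ u ∈ s, Tendsto (fun p : ℕ × ℝ => D p.1 p.2) (atTop ×ˢ 𝓝 u) (𝓝 (E u))) :
    ∀ u ∈ s, HasDerivAt W (E u) u := by
  intro u hu
  refine hasDerivAt_of_tendstoLocallyUniformlyOn hs (f' := D) ?_ (Eventually.of_forall hder) hV hu
  rw [hs.tendstoLocallyUniformlyOn_iff_forall_tendsto]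
  intro x hx
  have h1 : Tendsto (fun p : ℕ × ℝ => E p.2) (atTop ×ˢ 𝓝 x) (𝓝 (E x)) :=
    ((hE.continuousAt (hs.mem_nhds hx)).tendsto).comp tendsto_snd
  exact (h1.prodMk_nhds (hD x hx)).mono_right (nhds_le_uniformity _)

/-- Average of `Φ u` over `[v, v + ε]`. -/
def forwardAverage (Φ : ℝ → ℝ → ℝ) (ε u v : ℝ) : ℝ := (∫ w in v..v + ε, Φ u w) / ε

section ForwardAverage

variable {Φ : ℝ → ℝ → ℝ} {ε : ℝ}

lemma le_forwardAverage (hmono : ∀ u, Monotone (Φ u))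
    (hε : 0 < ε) (u v : ℝ) : Φ u v ≤ forwardAverage Φ ε u v := by
  rw [forwardAverage, le_div_iff₀ hε]
  have h := intervalIntegral.integral_mono_on (a := v) (b := v + ε) (f := fun _ => Φ u v)
    (g := Φ u) (μ := MeasureTheory.volume) (by linarith) intervalIntegrable_const
    ((hmono u).intervalIntegrable) (fun w hw => hmono u hw.1)
  simpa [mul_comm] using h

lemma forwardAverage_le (hmono : ∀ u, Monotone (Φ u))
    (hε : 0 < ε) (u v : ℝ) : forwardAverage Φ ε u v ≤ Φ u (v + ε) := by
  rw [forwardAverage, div_le_iff₀ hε]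
  have h := intervalIntegral.integral_mono_on (a := v) (b := v + ε) (g := fun _ => Φ u (v + ε))
    (f := Φ u) (μ := MeasureTheory.volume) (by linarith)
    ((hmono u).intervalIntegrable) intervalIntegrable_const (fun w hw => hmono u hw.2)
  simpa [mul_comm] using h

lemma lipschitzWith_forwardAverage (hmono : ∀ u, Monotone (Φ u)) {C : NNReal}
    (hC : ∀ u v, |Φ u v| ≤ C) (hε : 0 < ε) (u : ℝ) :
    LipschitzWith (Real.toNNReal (2 * C / ε)) (forwardAverage Φ ε u) := by
  refine LipschitzWith.of_dist_le_mul fun v w => ?_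
  have hint : ∀ a b : ℝ, IntervalIntegrable (Φ u) MeasureTheory.volume a b :=
    fun a b => (hmono u).intervalIntegrable
  have hbd : ∀ a b : ℝ, |∫ t in a..b, Φ u t| ≤ C * |b - a| := fun a b =>
    intervalIntegral.norm_integral_le_of_norm_le_const (f := Φ u) fun t _ => hC u t
  have hsplit : (∫ t in v..v + ε, Φ u t) - ∫ t in w..w + ε, Φ u t
      = (∫ t in v..w, Φ u t) - ∫ t in v + ε..w + ε, Φ u t := by
    rw [intervalIntegral.integral_interval_sub_interval_comm (hint _ _) (hint _ _) (hint _ _)]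
  rw [Real.coe_toNNReal _ (by positivity), Real.dist_eq, Real.dist_eq, forwardAverage,
    forwardAverage, ← sub_div, hsplit, abs_div, abs_of_pos hε, div_le_iff₀ hε]
  have h1 := hbd v w
  have h2 := hbd (v + ε) (w + ε)
  rw [show w + ε - (v + ε) = w - v by ring] at h2
  rw [abs_sub_comm v w]
  calc _ ≤ |∫ t in v..w, Φ u t| + |∫ t in v + ε..w + ε, Φ u t| := abs_sub _ _
    _ ≤ C * |w - v| + C * |w - v| := add_le_add h1 h2
    _ = 2 * C / ε * |w - v| * ε := by field_simp; ring

end ForwardAverage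

/-- Peano existence for a bounded field that is nondecreasing in the unknown, solved backwards
from a zero terminal value. -/
lemma exists_backward_solution_of_monotone {Φ : ℝ → ℝ → ℝ} {C : NNReal}
    (hcont : Continuous Φ.uncurry) (hmono : ∀ u, Monotone (Φ u)) (hC : ∀ u v, |Φ u v| ≤ C) :
    ∃ V : ℝ → ℝ, V 1 = 0 ∧ ContinuousOn V (Icc 0 1) ∧
      ∀ u ∈ Ioo (0 : ℝ) 1, HasDerivAt V (Φ u (V u)) u := by
  let ε : ℕ → ℝ := fun n => 1 / ((n : ℝ) + 1)
  have hε : ∀ n, 0 < ε n := fun n => Nat.one_div_pos_of_nat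
  have hεanti : ∀ n m, n ≤ m → ε m ≤ ε n := fun n m h => Nat.one_div_le_one_div h
  have hex : ∀ n, ∃ V : ℝ → ℝ, V 1 = 0 ∧ ContinuousOn V (Icc 0 1) ∧
      ∀ u ∈ Ioo (0 : ℝ) 1, HasDerivAt V (forwardAverage Φ (ε n) u (V u)) u := by
    intro n
    refine exists_backward_solution_of_lipschitz (C := C) ?_
      (lipschitzWith_forwardAverage hmono hC (hε n)) ?_
    · intro v
      exact (intervalIntegral.continuous_parametric_intervalIntegral_of_continuous'
        hcont _ _).div_const _
    · intro u v
      rw [abs_le]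
      exact ⟨(abs_le.1 (hC u v)).1.trans (le_forwardAverage hmono (hε n) u v),
        (forwardAverage_le hmono (hε n) u v).trans (abs_le.1 (hC u _)).2⟩
  choose V hV1 hVc hVd using hex
  have hcomp : ∀ n m, ∀ u ∈ Icc (0 : ℝ) 1, V n u - V m u ≤ ε m := by
    intro n m u hu
    suffices V n u - V m u - ε m ≤ 0 by linarith
    refine nonpos_of_deriv_nonneg_of_pos (d := fun u => V n u - V m u - ε m)
      (((hVc n).sub (hVc m)).sub continuousOn_const) (by simp [hV1, (hε m).le]) ?_ u hu
    intro x hx hpos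
    refine ⟨_, ?_, ((hVd n x hx).sub (hVd m x hx)).sub_const _⟩
    have h1 := forwardAverage_le hmono (hε m) x (V m x)
    have h2 := le_forwardAverage hmono (hε n) x (V n x)
    have h3 := hmono x (show V m x + ε m ≤ V n x by linarith)
    linarith
  obtain ⟨W, hWc, hW, hWj⟩ := exists_uniform_limit hVc (fun n m hnm u hu => by
    have h1 := hcomp n m u hu
    have h2 := hcomp m n u hu
    have h3 := hεanti n m hnm
    exact abs_le.2 ⟨by linarith, by linarith⟩)
  refine ⟨W, ?_, hWc, ?_⟩
  · refine tendsto_nhds_unique (hW 1 (by simp)) ?_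
    simp [hV1]
  have hΦW : ContinuousOn (fun u => Φ u (W u)) (Ioo 0 1) :=
    hcont.comp_continuousOn (continuousOn_id.prodMk (hWc.mono Ioo_subset_Icc_self))
  refine hasDerivAt_of_continuous_convergence isOpen_Ioo hVd
    (fun u hu => hW u (Ioo_subset_Icc_self hu)) hΦW fun u hu => ?_
  have hlow : Tendsto (fun p : ℕ × ℝ => Φ p.2 (V p.1 p.2)) (atTop ×ˢ 𝓝 u) (𝓝 (Φ u (W u))) :=
    (hcont.tendsto (u, W u)).comp (tendsto_snd.prodMk_nhds (hWj u hu))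
  have hε0 : Tendsto (fun p : ℕ × ℝ => ε p.1) (atTop ×ˢ 𝓝 u) (𝓝 0) :=
    tendsto_one_div_add_atTop_nhds_zero_nat.comp tendsto_fst
  have hupp : Tendsto (fun p : ℕ × ℝ => Φ p.2 (V p.1 p.2 + ε p.1)) (atTop ×ˢ 𝓝 u)
      (𝓝 (Φ u (W u))) := by
    have := (hcont.tendsto (u, W u + 0)).comp (tendsto_snd.prodMk_nhds ((hWj u hu).add hε0))
    simpa only [add_zero, Function.comp_def, Function.uncurry] using this
  exact tendsto_of_tendsto_of_tendsto_of_le_of_le hlow hupp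
    (fun p => le_forwardAverage hmono (hε p.1) _ _)
    (fun p => forwardAverage_le hmono (hε p.1) _ _)

namespace FluxData

variable (F : FluxData) {u s t v : ℝ}

lemma mem_OmegaSet_of_abs_le (hs : (u, s) ∈ OmegaSet F.ω) (h : |t| ≤ |s|) :
    (u, t) ∈ OmegaSet F.ω :=
  ⟨hs.1, (ENNReal.ofReal_le_ofReal h).trans_lt hs.2⟩

lemma zero_mem_OmegaSet (hu : u ∈ Icc (0 : ℝ) 1) : (u, (0 : ℝ)) ∈ OmegaSet F.ω :=
  ⟨hu, by simpa using F.ω_pos u hu⟩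

lemma a_zero (hu : u ∈ Icc (0 : ℝ) 1) : F.a u 0 = 0 := by
  have := F.a_odd u 0 (F.zero_mem_OmegaSet hu)
  rw [neg_zero] at this
  linarith

lemma strictMonoOn_a (u : ℝ) : StrictMonoOn (F.a u) {s | (u, s) ∈ OmegaSet F.ω} := by
  have hconv : Convex ℝ {s | (u, s) ∈ OmegaSet F.ω} := by
    refine OrdConnected.convex ⟨fun s hs t ht r hr => ?_⟩
    rcases le_max_iff.1 (abs_le_max_abs_abs hr.1 hr.2) with h | h
    · exact F.mem_OmegaSet_of_abs_le hs h
    · exact F.mem_OmegaSet_of_abs_le ht h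
  refine strictMonoOn_of_deriv_pos hconv ?_ ?_
  · intro s hs
    obtain ⟨d, -, hd⟩ := F.a_deriv_pos u s hs
    exact hd.continuousAt.continuousWithinAt
  · intro s hs
    obtain ⟨d, h0, hd⟩ := F.a_deriv_pos u s (interior_subset (s := {s | (u, s) ∈ OmegaSet F.ω}) hs)
    rwa [hd.deriv]

lemma eventually_mem_OmegaSet_fst (hs : (u, s) ∈ OmegaSet F.ω) :
    ∀ᶠ x in 𝓝[Icc 0 1] u, (x, s) ∈ OmegaSet F.ω := by
  filter_upwards [F.ω_lsc u hs.1 _ hs.2, self_mem_nhdsWithin] with x h1 h2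
  exact ⟨h2, h1⟩

lemma eventually_mem_OmegaSet_snd (hs : (u, s) ∈ OmegaSet F.ω) :
    ∀ᶠ t in 𝓝 s, (u, t) ∈ OmegaSet F.ω := by
  have hc : Continuous fun t : ℝ => ENNReal.ofReal |t| :=
    ENNReal.continuous_ofReal.comp continuous_abs
  filter_upwards [hc.continuousAt.eventually (gt_mem_nhds hs.2)] with t ht
  exact ⟨hs.1, ht⟩

lemma continuousWithinAt_a (hs : (u, s) ∈ OmegaSet F.ω) :
    ContinuousWithinAt (fun x => F.a x s) (Icc 0 1) u := by
  have h : ContinuousWithinAt (fun x => F.a x s) {x | (x, s) ∈ OmegaSet F.ω} u :=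
    (F.a_C1.continuousOn (u, s) hs).comp (f := fun x : ℝ => (x, s))
      (by fun_prop) fun x hx => hx
  exact h.mono_of_mem_nhdsWithin (F.eventually_mem_OmegaSet_fst hs)

lemma ofReal_a_le_aplus (h0 : 0 < s) (hs : (u, s) ∈ OmegaSet F.ω) :
    ENNReal.ofReal (F.a u s) ≤ F.aplus u := by
  rw [F.aplus_def u hs.1]
  exact le_iSup₂_of_le s ⟨h0, hs⟩ le_rfl

lemma g_mem (hu : u ∈ Icc (0 : ℝ) 1) (hv : 0 < v) (h : ENNReal.ofReal v < F.aplus u) :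
    0 < F.g u v ∧ (u, F.g u v) ∈ OmegaSet F.ω ∧ F.a u (F.g u v) = v := by
  obtain ⟨h1, h2⟩ := F.g_spec (u, v) ⟨hu, by rwa [abs_of_pos hv]⟩
  refine ⟨?_, h1, h2⟩
  rw [← (F.strictMonoOn_a u).lt_iff_lt (F.zero_mem_OmegaSet hu) h1, F.a_zero hu, h2]
  exact hv

end FluxData

lemma Hfun_of_lt (F : FluxData) {u v : ℝ} (h : ENNReal.ofReal v < F.aplus u) :
    Hfun F u v = 1 / F.g u v := if_pos h

lemma Hfun_of_not_lt (F : FluxData) {u v : ℝ} (h : ¬ENNReal.ofReal v < F.aplus u) :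
    Hfun F u v = 0 := if_neg h

lemma Hfun_nonneg (F : FluxData) {u v : ℝ} (hu : u ∈ Icc (0 : ℝ) 1) (hv : 0 < v) :
    0 ≤ Hfun F u v := by
  by_cases h : ENNReal.ofReal v < F.aplus u
  · rw [Hfun_of_lt F h]
    exact one_div_nonneg.2 (F.g_mem hu hv h).1.le
  · rw [Hfun_of_not_lt F h]

lemma Hfun_lt_of_a_lt (F : FluxData) {u v M : ℝ} (hM : 0 < M) (hMΩ : (u, M) ∈ OmegaSet F.ω)
    (hv : F.a u M < v) : Hfun F u v < 1 / M := by
  have haM : 0 < F.a u M := by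
    rw [← F.a_zero hMΩ.1]
    exact F.strictMonoOn_a u (F.zero_mem_OmegaSet hMΩ.1) hMΩ hM
  by_cases h : ENNReal.ofReal v < F.aplus u
  · obtain ⟨-, hgΩ, hag⟩ := F.g_mem hMΩ.1 (haM.trans hv) h
    rw [Hfun_of_lt F h]
    refine one_div_lt_one_div_of_lt hM ?_
    rwa [← (F.strictMonoOn_a u).lt_iff_lt hMΩ hgΩ, hag]
  · rw [Hfun_of_not_lt F h]
    positivity

lemma lt_Hfun_of_lt_a (F : FluxData) {u v M : ℝ} (hM : 0 < M) (hMΩ : (u, M) ∈ OmegaSet F.ω)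
    (hv0 : 0 < v) (hv : v < F.a u M) : 1 / M < Hfun F u v := by
  have h : ENNReal.ofReal v < F.aplus u :=
    ((ENNReal.ofReal_lt_ofReal_iff (hv0.trans hv)).2 hv).trans_le (F.ofReal_a_le_aplus hM hMΩ)
  obtain ⟨hg0, hgΩ, hag⟩ := F.g_mem hMΩ.1 hv0 h
  rw [Hfun_of_lt F h]
  refine one_div_lt_one_div_of_lt hg0 ?_
  rwa [← (F.strictMonoOn_a u).lt_iff_lt hgΩ hMΩ, hag]

lemma Hfun_antitoneOn (F : FluxData) {u : ℝ} (hu : u ∈ Icc (0 : ℝ) 1) :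
    AntitoneOn (Hfun F u) (Ioi 0) := by
  intro v hv w hw hvw
  by_cases h : ENNReal.ofReal w < F.aplus u
  · have h' := (ENNReal.ofReal_le_ofReal hvw).trans_lt h
    obtain ⟨-, hwΩ, haw⟩ := F.g_mem hu hw h
    obtain ⟨hg0, hvΩ, hav⟩ := F.g_mem hu hv h'
    rw [Hfun_of_lt F h, Hfun_of_lt F h']
    refine one_div_le_one_div_of_le hg0 ?_
    rwa [← (F.strictMonoOn_a u).le_iff_le hvΩ hwΩ, hav, haw]
  · rw [Hfun_of_not_lt F h]
    exact Hfun_nonneg F hu hv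

/-- A bound `ℋ(u,v) < c` is witnessed by a slope `M > 1/c` whose flux is below `v`. -/
lemma exists_a_lt_of_Hfun_lt (F : FluxData) {u v c : ℝ} (hu : u ∈ Icc (0 : ℝ) 1) (hv : 0 < v)
    (hc : Hfun F u v < c) :
    ∃ M > 0, 1 / M < c ∧ (u, M) ∈ OmegaSet F.ω ∧ F.a u M < v := by
  have hc0 : 0 < c := (Hfun_nonneg F hu hv).trans_lt hc
  by_cases h : ENNReal.ofReal v < F.aplus u
  · obtain ⟨hg0, hgΩ, hag⟩ := F.g_mem hu hv h
    rw [Hfun_of_lt F h, one_div_lt hg0 hc0] at hc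
    obtain ⟨M, hcM, hMg⟩ := exists_between hc
    have hM0 : 0 < M := (one_div_pos.2 hc0).trans hcM
    have hMΩ := F.mem_OmegaSet_of_abs_le hgΩ (t := M)
      (by rw [abs_of_pos hM0, abs_of_pos hg0]; exact hMg.le)
    refine ⟨M, hM0, (one_div_lt hc0 hM0).1 hcM, hMΩ, ?_⟩
    rw [← hag]
    exact F.strictMonoOn_a u hMΩ hgΩ hMg
  · have hω : F.ω u = ⊤ := by
      by_contra hne
      exact h (by simp [F.aplus_top u hu (lt_top_iff_ne_top.2 hne)])
    have hmem : ∀ s : ℝ, (u, s) ∈ OmegaSet F.ω := fun s => ⟨hu, by simp [hω]⟩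
    have hpos : (0 : ℝ) < 1 / c := one_div_pos.2 hc0
    have hM0 : (0 : ℝ) < 1 / c + 1 := by linarith
    refine ⟨1 / c + 1, hM0, ?_, hmem _, ?_⟩
    · rw [one_div_lt hM0 hc0]
      linarith
    · refine (F.strictMonoOn_a u (hmem _) (hmem (1 / c + 2)) (by linarith)).trans_le ?_
      refine (ENNReal.ofReal_le_ofReal_iff hv.le).1 ?_
      exact (F.ofReal_a_le_aplus (by linarith) (hmem _)).trans (not_lt.1 h)

/-- A bound `c < ℋ(u,v)` is witnessed by a slope `M < 1/c` whose flux is above `v`. -/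
lemma exists_lt_a_of_lt_Hfun (F : FluxData) {u v c : ℝ} (hu : u ∈ Icc (0 : ℝ) 1) (hv : 0 < v)
    (hc0 : 0 ≤ c) (hc : c < Hfun F u v) :
    ∃ M > 0, c < 1 / M ∧ (u, M) ∈ OmegaSet F.ω ∧ v < F.a u M := by
  have h : ENNReal.ofReal v < F.aplus u := by
    by_contra h
    rw [Hfun_of_not_lt F h] at hc
    linarith
  obtain ⟨hg0, hgΩ, hag⟩ := F.g_mem hu hv h
  rw [Hfun_of_lt F h] at hc
  have hcont : ContinuousAt (fun M : ℝ => 1 / M) (F.g u v) :=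
    continuousAt_const.div continuousAt_id hg0.ne'
  have hev : ∀ᶠ M in 𝓝[>] F.g u v, c < 1 / M ∧ (u, M) ∈ OmegaSet F.ω ∧ F.g u v < M :=
    ((hcont.eventually (lt_mem_nhds hc)).filter_mono nhdsWithin_le_nhds).and
      (((F.eventually_mem_OmegaSet_snd hgΩ).filter_mono nhdsWithin_le_nhds).and
        self_mem_nhdsWithin)
  obtain ⟨M, hcM, hMΩ, hgM⟩ := hev.exists
  refine ⟨M, hg0.trans hgM, hcM, hMΩ, ?_⟩
  rw [← hag]
  exact F.strictMonoOn_a u hgΩ hMΩ hgM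

lemma continuousOn_Hfun (F : FluxData) :
    ContinuousOn (fun p : ℝ × ℝ => Hfun F p.1 p.2) (Icc 0 1 ×ˢ Ioi 0) := by
  rintro ⟨u, v⟩ ⟨hu, hv⟩
  have hfst : Tendsto Prod.fst (𝓝[Icc (0 : ℝ) 1 ×ˢ Ioi (0 : ℝ)] (u, v)) (𝓝[Icc 0 1] u) :=
    tendsto_nhdsWithin_iff.2 ⟨continuous_fst.continuousAt.mono_left nhdsWithin_le_nhds,
      eventually_mem_nhdsWithin.mono fun p hp => hp.1⟩
  have hsnd : Tendsto Prod.snd (𝓝[Icc (0 : ℝ) 1 ×ˢ Ioi (0 : ℝ)] (u, v)) (𝓝 v) :=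
    continuous_snd.continuousAt.mono_left nhdsWithin_le_nhds
  refine tendsto_order.2 ⟨fun c hc => ?_, fun c hc => ?_⟩
  · rcases lt_or_ge c 0 with hc0 | hc0
    · filter_upwards [self_mem_nhdsWithin] with p hp
      exact hc0.trans_le (Hfun_nonneg F hp.1 hp.2)
    obtain ⟨M, hM0, hcM, hMΩ, hvM⟩ := exists_lt_a_of_lt_Hfun F hu hv hc0 hc
    filter_upwards [self_mem_nhdsWithin, hfst.eventually (F.eventually_mem_OmegaSet_fst hMΩ),
      hsnd.eventually_lt ((F.continuousWithinAt_a hMΩ).tendsto.comp hfst) hvM] with p h1 h2 h3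
    exact hcM.trans (lt_Hfun_of_lt_a F hM0 h2 h1.2 h3)
  · obtain ⟨M, hM0, hcM, hMΩ, hvM⟩ := exists_a_lt_of_Hfun_lt F hu hv hc
    filter_upwards [hfst.eventually (F.eventually_mem_OmegaSet_fst hMΩ),
      ((F.continuousWithinAt_a hMΩ).tendsto.comp hfst).eventually_lt hsnd hvM] with p h1 h2
    exact (Hfun_lt_of_a_lt F hM0 h1 h2).trans hcM

lemma exists_lt_Hfun (F : FluxData) {u : ℝ} (hu : u ∈ Icc (0 : ℝ) 1) (M : ℝ) :
    ∃ η > 0, M < Hfun F u η := by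
  have hev : ∀ᶠ s in 𝓝[>] (0 : ℝ), (u, s) ∈ OmegaSet F.ω ∧ M < s⁻¹ ∧ 0 < s :=
    ((F.eventually_mem_OmegaSet_snd (F.zero_mem_OmegaSet hu)).filter_mono
      nhdsWithin_le_nhds).and
      ((tendsto_inv_nhdsGT_zero.eventually (eventually_gt_atTop M)).and self_mem_nhdsWithin)
  obtain ⟨s, hsΩ, hMs, hs⟩ := hev.exists
  have has : 0 < F.a u s := by
    rw [← F.a_zero hu]
    exact F.strictMonoOn_a u (F.zero_mem_OmegaSet hu) hsΩ hs
  refine ⟨F.a u s / 2, half_pos has, hMs.trans ?_⟩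
  rw [← one_div]
  exact lt_Hfun_of_lt_a F hs hsΩ (half_pos has) (half_lt_self has)

lemma FluxData.f_nonneg (F : FluxData) {u : ℝ} (hu : u ∈ Icc (0 : ℝ) 1) : 0 ≤ F.f u := by
  rcases hu.1.eq_or_lt with rfl | h0
  · exact F.f_zero.ge
  rcases hu.2.eq_or_lt with rfl | h1
  · exact F.f_one.ge
  exact (F.f_pos u ⟨h0, h1⟩).le

lemma mul_Hfun_antitone (F : FluxData) {u v w : ℝ} (hu : u ∈ Icc (0 : ℝ) 1) (hv : 0 < v)
    (hvw : v ≤ w) : F.f u * Hfun F u w ≤ F.f u * Hfun F u v :=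
  mul_le_mul_of_nonneg_left (Hfun_antitoneOn F hu hv (hv.trans_le hvw) hvw) (F.f_nonneg hu)

lemma continuousOn_mul_Hfun (F : FluxData) :
    ContinuousOn (fun p : ℝ × ℝ => F.f p.1 * Hfun F p.1 p.2) (Icc 0 1 ×ˢ Ioi 0) :=
  (F.f_C1.continuousOn.comp continuousOn_fst fun _ hp => hp.1).mul (continuousOn_Hfun F)

lemma continuousAt_mul_Hfun (F : FluxData) {u v : ℝ} (hu : u ∈ Ioo (0 : ℝ) 1) (hv : 0 < v) :
    ContinuousAt (fun p : ℝ × ℝ => F.f p.1 * Hfun F p.1 p.2) (u, v) :=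
  (continuousOn_mul_Hfun F).continuousAt
    (prod_mem_nhds (Icc_mem_nhds hu.1 hu.2) (Ioi_mem_nhds hv))

/-- Projection of the line onto `[0,1]`. -/
def clampUnit (x : ℝ) : ℝ := max 0 (min x 1)

lemma continuous_clampUnit : Continuous clampUnit := by
  unfold clampUnit; fun_prop

lemma monotone_clampUnit : Monotone clampUnit := fun _ _ h =>
  max_le_max le_rfl (min_le_min h le_rfl)

lemma clampUnit_mem (x : ℝ) : clampUnit x ∈ Icc (0 : ℝ) 1 :=
  ⟨le_max_left _ _, max_le zero_le_one (min_le_right _ _)⟩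

lemma clampUnit_of_mem {x : ℝ} (hx : x ∈ Icc (0 : ℝ) 1) : clampUnit x = x := by
  simp [clampUnit, hx.1, hx.2]

lemma clampUnit_of_nonpos {x : ℝ} (hx : x ≤ 0) : clampUnit x = 0 :=
  max_eq_left ((min_le_left _ _).trans hx)

lemma clampUnit_of_one_le {x : ℝ} (hx : 1 ≤ x) : clampUnit x = 1 := by
  simp [clampUnit, hx]

/-- Field that agrees with `σ - f ℋ` for `v ≥ δ`, is bounded and nondecreasing in `v`,
and is nonpositive for `v ≤ 0`. -/
def truncatedField (F : FluxData) (σ δ u v : ℝ) : ℝ :=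
  min (σ - F.f (clampUnit u) * Hfun F (clampUnit u) (max v δ)) (σ * clampUnit (v / δ))

section TruncatedField

variable (F : FluxData) {σ δ : ℝ}

lemma continuous_truncatedField (hδ : 0 < δ) :
    Continuous (truncatedField F σ δ).uncurry := by
  have h : Continuous fun p : ℝ × ℝ => F.f (clampUnit p.1) *
      Hfun F (clampUnit p.1) (max p.2 δ) :=
    (continuousOn_mul_Hfun F).comp_continuous
      ((continuous_clampUnit.comp continuous_fst).prodMk (continuous_snd.max continuous_const))
      fun p => ⟨clampUnit_mem _, hδ.trans_le (le_max_right _ _)⟩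
  exact (continuous_const.sub h).min
    (continuous_const.mul (continuous_clampUnit.comp (continuous_snd.div_const _)))

lemma monotone_truncatedField (hσ : 0 ≤ σ) (hδ : 0 < δ) (u : ℝ) :
    Monotone (truncatedField F σ δ u) := fun _ _ hvw =>
  min_le_min
    (sub_le_sub_left (mul_Hfun_antitone F (clampUnit_mem u) (hδ.trans_le (le_max_right _ _))
      (max_le_max hvw le_rfl)) _)
    (mul_le_mul_of_nonneg_left (monotone_clampUnit (div_le_div_of_nonneg_right hvw hδ.le)) hσ)

lemma exists_abs_truncatedField_le (hσ : 0 ≤ σ) (hδ : 0 < δ) :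
    ∃ C : NNReal, ∀ u v, |truncatedField F σ δ u v| ≤ C := by
  have hc : ContinuousOn (fun u => F.f u * Hfun F u δ) (Icc 0 1) :=
    (continuousOn_mul_Hfun F).comp (continuousOn_id.prodMk continuousOn_const)
      fun u hu => ⟨hu, hδ⟩
  obtain ⟨M, hM⟩ := isCompact_Icc.bddAbove_image hc
  have hM' : ∀ u ∈ Icc (0 : ℝ) 1, F.f u * Hfun F u δ ≤ M := fun u hu => hM ⟨u, hu, rfl⟩
  have hM0 : 0 ≤ M := le_trans
    (mul_nonneg (F.f_nonneg (by simp)) (Hfun_nonneg F (by simp) hδ)) (hM' 0 (by simp))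
  refine ⟨Real.toNNReal (σ + M), fun u v => ?_⟩
  rw [Real.coe_toNNReal _ (by positivity)]
  refine abs_le.2 ⟨le_min ?_ ?_, (min_le_right _ _).trans ?_⟩
  · have h1 := mul_Hfun_antitone F (clampUnit_mem u) hδ (le_max_right v δ)
    have h2 := hM' _ (clampUnit_mem u)
    linarith
  · have := mul_nonneg hσ (clampUnit_mem (v / δ)).1
    linarith
  · have := mul_le_mul_of_nonneg_left (clampUnit_mem (v / δ)).2 hσ
    linarith

lemma truncatedField_nonpos (hδ : 0 < δ) (u : ℝ) {v : ℝ} (hv : v ≤ 0) :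
    truncatedField F σ δ u v ≤ 0 := by
  refine (min_le_right _ _).trans ?_
  rw [clampUnit_of_nonpos (div_nonpos_of_nonpos_of_nonneg hv hδ.le), mul_zero]

lemma truncatedField_le {u : ℝ} (hu : u ∈ Icc (0 : ℝ) 1) (v : ℝ) :
    truncatedField F σ δ u v ≤ σ - F.f u * Hfun F u (max v δ) := by
  refine (min_le_left _ _).trans ?_
  rw [clampUnit_of_mem hu]

lemma truncatedField_eq (hδ : 0 < δ) {u v : ℝ} (hu : u ∈ Icc (0 : ℝ) 1) (hv : δ ≤ v) :
    truncatedField F σ δ u v = σ - F.f u * Hfun F u v := by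
  rw [truncatedField, clampUnit_of_mem hu, max_eq_left hv,
    clampUnit_of_one_le ((one_le_div hδ).2 hv), mul_one]
  refine min_eq_left ?_
  have := mul_nonneg (F.f_nonneg hu) (Hfun_nonneg F hu (hδ.trans_le hv))
  linarith

end TruncatedField

/-- `V` solves the problem with truncated field and zero terminal value. -/
def IsTruncatedSol (F : FluxData) (σ δ : ℝ) (V : ℝ → ℝ) : Prop :=
  V 1 = 0 ∧ ContinuousOn V (Icc 0 1) ∧
    ∀ u ∈ Ioo (0 : ℝ) 1, HasDerivAt V (truncatedField F σ δ u (V u)) u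

namespace IsTruncatedSol

variable {F : FluxData} {σ δ δ' : ℝ} {V W : ℝ → ℝ}

lemma nonneg (hV : IsTruncatedSol F σ δ V) (hδ : 0 < δ) :
    ∀ u ∈ Icc (0 : ℝ) 1, 0 ≤ V u := by
  intro u hu
  suffices -V u ≤ 0 by linarith
  refine nonpos_of_deriv_nonneg_of_pos (d := fun u => -V u) hV.2.1.neg (by simp [hV.1]) ?_ u hu
  intro x hx hpos
  exact ⟨_, neg_nonneg.2 (truncatedField_nonpos F hδ x (by linarith)), (hV.2.2 x hx).neg⟩

lemma sub_le_max (hV : IsTruncatedSol F σ δ V) (hW : IsTruncatedSol F σ δ' W) (hσ : 0 ≤ σ)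
    (hδ : 0 < δ) (hδ' : 0 < δ') : ∀ u ∈ Icc (0 : ℝ) 1, V u - W u ≤ max δ δ' := by
  intro u hu
  suffices V u - W u - max δ δ' ≤ 0 by linarith
  refine nonpos_of_deriv_nonneg_of_pos (d := fun u => V u - W u - max δ δ')
    ((hV.2.1.sub hW.2.1).sub continuousOn_const) (by simp [hV.1, hW.1, hδ.le]) ?_ u hu
  intro x hx hpos
  have hx' := Ioo_subset_Icc_self hx
  refine ⟨_, ?_, ((hV.2.2 x hx).sub (hW.2.2 x hx)).sub_const _⟩
  have h0 := hW.nonneg hδ' x hx'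
  have h1 := le_max_left δ δ'
  have h2 := le_max_right δ δ'
  have h3 := monotone_truncatedField F hσ hδ' x (show W x ≤ V x by linarith)
  rw [truncatedField_eq F hδ' hx' (by linarith : δ' ≤ V x)] at h3
  rw [truncatedField_eq F hδ hx' (by linarith : δ ≤ V x)]
  linarith

end IsTruncatedSol

/-- A positive lower bound at an interior point, uniform in the truncation level. -/
lemma exists_pos_le_truncatedSol (F : FluxData) (σ : ℝ) {u : ℝ} (hu : u ∈ Ioo (0 : ℝ) 1) :
    ∃ c > 0, ∃ η > 0, ∀ δ, 0 < δ → δ < η → ∀ V, IsTruncatedSol F σ δ V → c ≤ V u := by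
  have hfu := F.f_pos u hu
  obtain ⟨η, hη, hM⟩ := exists_lt_Hfun F (Ioo_subset_Icc_self hu) ((σ + 1) / F.f u)
  rw [div_lt_iff₀' hfu] at hM
  have hcont : ContinuousAt (fun x => F.f x * Hfun F x η) u :=
    ContinuousAt.comp (f := fun x : ℝ => (x, η)) (continuousAt_mul_Hfun F hu hη) (by fun_prop)
  have hev : ∀ᶠ x in 𝓝 u, σ + 1 < F.f x * Hfun F x η ∧ x ∈ Ioo (0 : ℝ) 1 :=
    (hcont.eventually (lt_mem_nhds hM)).and (Ioo_mem_nhds hu.1 hu.2)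
  obtain ⟨h, hh, hball⟩ := Metric.nhds_basis_closedBall.eventually_iff.1 hev
  have hball' : ∀ x ∈ Icc u (u + h), σ + 1 < F.f x * Hfun F x η ∧ x ∈ Ioo (0 : ℝ) 1 := by
    intro x hx
    refine hball ?_
    rw [Real.closedBall_eq_Icc]
    exact ⟨by linarith [hx.1], hx.2⟩
  obtain ⟨κ, hκ, hκ1, hκη⟩ : ∃ κ > 0, κ ≤ 1 ∧ κ * h ≤ η :=
    ⟨min 1 (η / h), by positivity, min_le_left _ _,
      (le_div_iff₀ hh).1 (min_le_right _ _)⟩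
  refine ⟨κ * h, by positivity, η, hη, fun δ hδ hδη V hV => ?_⟩
  have hsub : Icc u (u + h) ⊆ Icc 0 1 := fun x hx => Ioo_subset_Icc_self (hball' x hx).2
  suffices κ * (u + h - u) - V u ≤ 0 by linarith
  refine nonpos_of_deriv_nonneg_of_pos (a := u) (b := u + h) (d := fun x => κ * (u + h - x) - V x)
    ((by fun_prop : Continuous fun x => κ * (u + h - x)).continuousOn.sub (hV.2.1.mono hsub))
    ?_ ?_ u ⟨le_rfl, by linarith⟩
  · have := hV.nonneg hδ (u + h) (hsub ⟨by linarith, le_rfl⟩)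
    simpa using this
  · intro x hx hpos
    obtain ⟨hfx, hx01⟩ := hball' x (Ioo_subset_Icc_self hx)
    refine ⟨_, ?_, (((hasDerivAt_id x).const_sub (u + h)).const_mul κ).sub (hV.2.2 x hx01)⟩
    have hVη : V x ≤ η := by nlinarith [hx.1, hx.2]
    have h1 := truncatedField_le F (σ := σ) (δ := δ) (Ioo_subset_Icc_self hx01) (V x)
    have h2 := mul_Hfun_antitone F (Ioo_subset_Icc_self hx01)
      (hδ.trans_le (le_max_right (V x) δ)) (max_le hVη hδη.le)
    linarith

lemma exists_isVsol (F : FluxData) {σ : ℝ} (hσ : 0 ≤ σ) : ∃ V, IsVsol F σ V := by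
  let δ : ℕ → ℝ := fun n => 1 / ((n : ℝ) + 1)
  have hδ : ∀ n, 0 < δ n := fun n => Nat.one_div_pos_of_nat
  have hδanti : ∀ n m, n ≤ m → δ m ≤ δ n := fun n m h => Nat.one_div_le_one_div h
  have hδ0 : Tendsto δ atTop (𝓝 0) := tendsto_one_div_add_atTop_nhds_zero_nat
  have hex : ∀ n, ∃ V : ℝ → ℝ, IsTruncatedSol F σ (δ n) V := by
    intro n
    obtain ⟨C, hC⟩ := exists_abs_truncatedField_le F hσ (hδ n)
    exact exists_backward_solution_of_monotone (continuous_truncatedField F (hδ n))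
      (monotone_truncatedField F hσ (hδ n)) hC
  choose V hV using hex
  obtain ⟨W, hWc, hW, hWj⟩ := exists_uniform_limit (fun n => (hV n).2.1) (fun n m hnm u hu => by
    have h1 := (hV n).sub_le_max (hV m) hσ (hδ n) (hδ m) u hu
    have h2 := (hV m).sub_le_max (hV n) hσ (hδ m) (hδ n) u hu
    rw [max_eq_left (hδanti n m hnm)] at h1
    rw [max_eq_right (hδanti n m hnm)] at h2
    exact abs_le.2 ⟨by linarith, by linarith⟩)
  have hWpos : ∀ u ∈ Ioo (0 : ℝ) 1, 0 < W u := by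
    intro u hu
    obtain ⟨c, hc, η, hη, hcη⟩ := exists_pos_le_truncatedSol F σ hu
    refine hc.trans_le (ge_of_tendsto (hW u (Ioo_subset_Icc_self hu)) ?_)
    filter_upwards [hδ0.eventually (gt_mem_nhds hη)] with n hn
    exact hcη _ (hδ n) hn _ (hV n)
  refine ⟨W, hWc, ?_, hWpos, ?_⟩
  · refine tendsto_nhds_unique (hW 1 (by simp)) ?_
    simp [fun n => (hV n).1]
  refine hasDerivAt_of_continuous_convergence isOpen_Ioo (fun n => (hV n).2.2)
    (fun u hu => hW u (Ioo_subset_Icc_self hu)) ?_ fun u hu => ?_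
  · exact continuousOn_const.sub ((continuousOn_mul_Hfun F).comp
      (continuousOn_id.prodMk (hWc.mono Ioo_subset_Icc_self))
      fun u hu => ⟨Ioo_subset_Icc_self hu, hWpos u hu⟩)
  · have hW2 : 0 < W u / 2 := half_pos (hWpos u hu)
    have hlim : Tendsto (fun p : ℕ × ℝ => σ - F.f p.2 * Hfun F p.2 (V p.1 p.2))
        (atTop ×ˢ 𝓝 u) (𝓝 (σ - F.f u * Hfun F u (W u))) :=
      ((continuousAt_mul_Hfun F hu (hWpos u hu)).tendsto.comp
        (tendsto_snd.prodMk_nhds (hWj u hu))).const_sub σ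
    refine hlim.congr' ?_
    filter_upwards [tendsto_fst.eventually (hδ0.eventually (gt_mem_nhds hW2)),
      (hWj u hu).eventually (lt_mem_nhds (half_lt_self (hWpos u hu))),
      tendsto_snd.eventually (Ioo_mem_nhds hu.1 hu.2)] with p h1 h2 h3
    exact (truncatedField_eq F (hδ p.1) (Ioo_subset_Icc_self h3) (h1.trans h2).le).symm

namespace IsVsol

variable {F : FluxData} {σ τ : ℝ} {V W : ℝ → ℝ}

lemma le_of_speed_le (hV : IsVsol F σ V) (hW : IsVsol F τ W) (hστ : σ ≤ τ) :
    ∀ u ∈ Icc (0 : ℝ) 1, W u ≤ V u := by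
  intro u hu
  suffices W u - V u ≤ 0 by linarith
  refine nonpos_of_deriv_nonneg_of_pos (d := fun u => W u - V u) (hW.1.sub hV.1)
    (by simp [hV.2.1, hW.2.1]) ?_ u hu
  intro x hx hpos
  refine ⟨_, ?_, (hW.2.2.2 x hx).sub (hV.2.2.2 x hx)⟩
  have := mul_Hfun_antitone F (Ioo_subset_Icc_self hx) (hV.2.2.1 x hx)
    (show V x ≤ W x by linarith)
  linarith

lemma sub_le_of_speed_le (hV : IsVsol F σ V) (hW : IsVsol F τ W) (hστ : σ ≤ τ) :
    ∀ u ∈ Icc (0 : ℝ) 1, V u - W u ≤ τ - σ := by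
  intro u hu
  suffices V u - W u - (τ - σ) * (1 - u) ≤ 0 by nlinarith [hu.1]
  refine nonpos_of_deriv_nonneg_of_pos (d := fun u => V u - W u - (τ - σ) * (1 - u))
    ((hV.1.sub hW.1).sub (by fun_prop)) (by simp [hV.2.1, hW.2.1]) ?_ u hu
  intro x hx hpos
  refine ⟨_, ?_, ((hV.2.2.2 x hx).sub (hW.2.2.2 x hx)).sub
    (((hasDerivAt_id x).const_sub 1).const_mul (τ - σ))⟩
  have := mul_Hfun_antitone F (Ioo_subset_Icc_self hx) (hW.2.2.1 x hx)
    (show W x ≤ V x by nlinarith [hx.2])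
  linarith

lemma abs_sub_le (hV : IsVsol F σ V) (hW : IsVsol F τ W) :
    ∀ u ∈ Icc (0 : ℝ) 1, |V u - W u| ≤ |σ - τ| := by
  intro u hu
  wlog hστ : σ ≤ τ generalizing σ τ V W
  · rw [abs_sub_comm, abs_sub_comm σ]
    exact this hW hV (le_of_not_ge hστ)
  · rw [abs_of_nonneg (sub_nonneg.2 (hV.le_of_speed_le hW hστ u hu)), abs_sub_comm,
      abs_of_nonneg (sub_nonneg.2 hστ)]
    exact hV.sub_le_of_speed_le hW hστ u hu

lemma lt_of_speed_lt (hV : IsVsol F σ V) (hW : IsVsol F τ W) (hστ : σ < τ) :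
    ∀ u ∈ Ioo (0 : ℝ) 1, W u < V u := by
  intro u hu
  refine lt_of_le_of_ne (hV.le_of_speed_le hW hστ.le u (Ioo_subset_Icc_self hu)) fun heq => ?_
  have hmax : IsLocalMax (fun x => W x - V x) u := by
    filter_upwards [Ioo_mem_nhds hu.1 hu.2] with x hx
    have := hV.le_of_speed_le hW hστ.le x (Ioo_subset_Icc_self hx)
    linarith
  have := hmax.hasDerivAt_eq_zero ((hW.2.2.2 u hu).sub (hV.2.2.2 u hu))
  rw [heq] at this
  linarith

end IsVsol

theorem stmt6 (F : FluxData) (hc : ContinuousOn F.aplus (Set.Icc (0:ℝ) 1)) :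
    ∃ 𝒱 : ℝ → ℝ → ℝ,
      (∀ σ : ℝ, 0 ≤ σ → IsVsol F σ (𝒱 σ)) ∧
      (∀ σ : ℝ, 0 ≤ σ → ∀ W : ℝ → ℝ, IsVsol F σ W → ∀ u ∈ Set.Icc (0:ℝ) 1, W u = 𝒱 σ u) ∧
      ContinuousOn (fun p : ℝ × ℝ => 𝒱 p.2 p.1) (Set.Icc (0:ℝ) 1 ×ˢ Set.Ici (0:ℝ)) ∧
      (∀ u ∈ Set.Ioo (0:ℝ) 1, StrictAntiOn (fun σ : ℝ => 𝒱 σ u) (Set.Ici (0:ℝ))) := by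
  have hex : ∀ σ : ℝ, ∃ V : ℝ → ℝ, 0 ≤ σ → IsVsol F σ V := by
    intro σ
    by_cases hσ : 0 ≤ σ
    · obtain ⟨V, hV⟩ := exists_isVsol F hσ
      exact ⟨V, fun _ => hV⟩
    · exact ⟨0, fun h => absurd h hσ⟩
  choose 𝒱 h𝒱 using hex
  refine ⟨𝒱, h𝒱, ?_, ?_, ?_⟩
  · intro σ hσ W hW u hu
    exact le_antisymm ((h𝒱 σ hσ).le_of_speed_le hW le_rfl u hu)
      (hW.le_of_speed_le (h𝒱 σ hσ) le_rfl u hu)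
  · rintro ⟨u, σ⟩ ⟨hu, hσ⟩
    have h1 : Tendsto (fun p : ℝ × ℝ => 𝒱 σ p.1) (𝓝[Icc 0 1 ×ˢ Ici 0] (u, σ)) (𝓝 (𝒱 σ u)) :=
      ((h𝒱 σ hσ).1.comp continuousOn_fst fun _ hp => hp.1) (u, σ) ⟨hu, hσ⟩
    refine (tendsto_iff_of_dist ?_).1 h1
    have h2 : Tendsto (fun p : ℝ × ℝ => |σ - p.2|) (𝓝[Icc 0 1 ×ˢ Ici 0] (u, σ)) (𝓝 0) := by
      have : Continuous fun p : ℝ × ℝ => |σ - p.2| := by fun_prop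
      simpa using (this.tendsto (u, σ)).mono_left nhdsWithin_le_nhds
    refine squeeze_zero' (Eventually.of_forall fun _ => dist_nonneg) ?_ h2
    filter_upwards [self_mem_nhdsWithin] with p hp
    exact (h𝒱 σ hσ).abs_sub_le (h𝒱 p.2 hp.2) p.1 hp.1
  · intro u hu σ hσ τ hτ hστ
    exact (h𝒱 σ hσ).lt_of_speed_lt (h𝒱 τ hτ) hστ u hu
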